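/- arXiv:2404.14493 — 2 statements merged into one kernel-verified Lean document; each statement's English description precedes it below -/
import Mathlib

section
/- Let n be an even positive integer and let m = n/2. Let V₁, …, V_m be independent Haar-random elements of the unitary group U(4), and consider the n-qubit state Ψ = (V₁ ⊗ V₂ ⊗ … ⊗ V_m)|0^n⟩ ∈ (ℂ⁴)^{⊗ m} ≅ (ℂ²)^{⊗ n}, i.e., the tensor product of m independent Haar-random two-qubit states V_i e₀. Then the expected peak weight of Ψ over the computational basis satisfies E[ max_{s ∈ {0,1}^n} |⟨s|Ψ⟩|² ] = (25/48)^{n/2}. -/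
open Matrix MeasureTheory

/-- The computational-basis amplitude `⟨s|Ψ⟩` of the `2m`-qubit product state
`Ψ = (V₁ ⊗ ⋯ ⊗ V_m)|0…0⟩`, where each `V i ∈ U(4)` acts on the pair of qubits
`(2i, 2i+1)` and `s : Fin (2m) → Fin 2` is a bit string: it is the product over the
pairs of the entries of the two-qubit states `V i |00⟩`. -/
noncomputable def productStateAmp (m : ℕ) (V : Fin m → Matrix.unitaryGroup (Fin 4) ℂ)
    (s : Fin (2 * m) → Fin 2) : ℂ :=
  ∏ i : Fin m,
    ((V i : Matrix (Fin 4) (Fin 4) ℂ) *ᵥ (Pi.single 0 1 : Fin 4 → ℂ))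
      ⟨2 * (s ⟨2 * i.val, by omega⟩).val + (s ⟨2 * i.val + 1, by omega⟩).val, by
        have h1 := (s ⟨2 * i.val, by omega⟩).isLt
        have h2 := (s ⟨2 * i.val + 1, by omega⟩).isLt
        omega⟩

/-- The density `π⁻¹ exp (-‖z‖²)` of the standard complex Gaussian. -/
noncomputable def complexGaussianDensity (z : ℂ) : ℝ := Real.pi⁻¹ * Real.exp (-‖z‖ ^ 2)

/-- The standard complex Gaussian measure on `ℂ`. -/
noncomputable def complexGaussian : Measure ℂ :=
  volume.withDensity fun z => ENNReal.ofReal (complexGaussianDensity z)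

lemma complexGaussianDensity_nonneg (z : ℂ) : 0 ≤ complexGaussianDensity z := by
  unfold complexGaussianDensity; positivity

lemma continuous_complexGaussianDensity : Continuous complexGaussianDensity := by
  unfold complexGaussianDensity; fun_prop

lemma lintegral_Ioi_two_mul_mul_exp_neg_sq {a : ℝ} (ha : 0 ≤ a) :
    ∫⁻ r in Set.Ioi a, ENNReal.ofReal (2 * r * Real.exp (-r ^ 2)) =
      ENNReal.ofReal (Real.exp (-a ^ 2)) := by
  have hd : ∀ x ∈ Set.Ici a, HasDerivAt (fun r : ℝ => -Real.exp (-r ^ 2))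
      (2 * x * Real.exp (-x ^ 2)) x := by
    intro x _
    convert! (((hasDerivAt_id x).pow 2).neg.exp).neg using 1
    simp; ring
  have hn : ∀ x ∈ Set.Ioi a, 0 ≤ 2 * x * Real.exp (-x ^ 2) := by
    intro x hx
    have : 0 ≤ x := ha.trans (le_of_lt hx)
    positivity
  have ht : Filter.Tendsto (fun r : ℝ => -Real.exp (-r ^ 2)) Filter.atTop (nhds 0) := by
    rw [← neg_zero]
    refine (Real.tendsto_exp_neg_atTop_nhds_zero.comp ?_).neg
    exact Filter.tendsto_pow_atTop two_ne_zero
  rw [← ofReal_integral_eq_lintegral_ofReal (integrableOn_Ioi_deriv_of_nonneg' hd hn ht),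
    integral_Ioi_of_hasDerivAt_of_nonneg' hd hn ht]
  · simp
  · exact (ae_restrict_iff' measurableSet_Ioi).2 (Filter.Eventually.of_forall hn)

lemma complexGaussian_le_norm_sq {t : ℝ} (ht : 0 ≤ t) :
    complexGaussian {z | t ≤ ‖z‖ ^ 2} = ENNReal.ofReal (Real.exp (-t)) := by
  have hm : MeasurableSet {z : ℂ | t ≤ ‖z‖ ^ 2} :=
    (isClosed_le continuous_const (by fun_prop)).measurableSet
  rw [complexGaussian, withDensity_apply _ hm, ← lintegral_indicator hm,
    ← Complex.lintegral_comp_polarCoord_symm]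
  have hpt : ∀ p ∈ polarCoord.target, ENNReal.ofReal p.1 •
      {z : ℂ | t ≤ ‖z‖ ^ 2}.indicator (fun z => ENNReal.ofReal (complexGaussianDensity z))
        (Complex.polarCoord.symm p) =
      (Set.Ici (√t)).indicator (fun r => ENNReal.ofReal (2 * r * Real.exp (-r ^ 2))) p.1 *
        ENNReal.ofReal (2 * Real.pi)⁻¹ := by
    intro p hp
    have hp0 : 0 < p.1 := by
      simp only [polarCoord_target, Set.mem_prod, Set.mem_Ioi] at hp
      exact hp.1
    simp only [Set.indicator, Set.mem_ofPred_eq, Set.mem_Ici, complexGaussianDensity,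
      Complex.norm_polarCoord_symm, sq_abs, Real.sqrt_le_left hp0.le]
    split_ifs
    · rw [smul_eq_mul, ← ENNReal.ofReal_mul hp0.le, ← ENNReal.ofReal_mul (by positivity)]
      congr 1
      field_simp
    · simp
  rw [setLIntegral_congr_fun polarCoord.open_target.measurableSet hpt, polarCoord_target,
    Measure.volume_eq_prod, ← Measure.prod_restrict, lintegral_prod_mul
      (Measurable.aemeasurable (Measurable.indicator (by fun_prop) measurableSet_Ici))
      aemeasurable_const, lintegral_indicator measurableSet_Ici,
    Measure.restrict_restrict measurableSet_Ici]
  have hae : (Set.Ici (√t) ∩ Set.Ioi 0 : Set ℝ) =ᵐ[volume] Set.Ioi (√t) := by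
    have h := (Ioi_ae_eq_Ici (μ := (volume : Measure ℝ)) (a := √t)).symm.inter
      (Filter.EventuallyEq.refl _ (Set.Ioi (0 : ℝ)))
    rwa [Set.inter_eq_left.2 (Set.Ioi_subset_Ioi (Real.sqrt_nonneg t))] at h
  rw [Measure.restrict_congr_set hae, lintegral_Ioi_two_mul_mul_exp_neg_sq (Real.sqrt_nonneg t),
    lintegral_const, Measure.restrict_apply_univ, Real.volume_Ioo,
    ← ENNReal.ofReal_mul (by positivity), Real.sq_sqrt ht,
    ← ENNReal.ofReal_mul (by positivity)]
  congr 1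
  field_simp
  ring

instance : IsProbabilityMeasure complexGaussian := ⟨by
  have h := complexGaussian_le_norm_sq le_rfl
  have hu : {z : ℂ | 0 ≤ ‖z‖ ^ 2} = Set.univ := Set.eq_univ_of_forall fun z => sq_nonneg ‖z‖
  simpa [hu] using h⟩

lemma complexGaussian_ball {t : ℝ} (ht : 0 ≤ t) :
    complexGaussian (Metric.ball 0 (√t)) = ENNReal.ofReal (1 - Real.exp (-t)) := by
  have h : Metric.ball (0 : ℂ) (√t) = {z | t ≤ ‖z‖ ^ 2}ᶜ := by
    ext z
    simp [Real.lt_sqrt]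
  rw [h, prob_compl_eq_one_sub (isClosed_le continuous_const (by fun_prop)).measurableSet,
    complexGaussian_le_norm_sq ht, ENNReal.ofReal_sub _ (Real.exp_pos _).le, ENNReal.ofReal_one]

lemma lintegral_norm_sq_complexGaussian :
    ∫⁻ z, ENNReal.ofReal (‖z‖ ^ 2) ∂complexGaussian = 1 := by
  rw [lintegral_eq_lintegral_meas_le _ (Filter.Eventually.of_forall fun z => sq_nonneg ‖z‖)
      (by fun_prop),
    setLIntegral_congr_fun measurableSet_Ioi fun t ht => complexGaussian_le_norm_sq (le_of_lt ht),
    ← ofReal_integral_eq_lintegral_ofReal, integral_exp_neg_Ioi_zero, ENNReal.ofReal_one]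
  · simpa [IntegrableOn] using integrableOn_exp_mul_Ioi (show (-1 : ℝ) < 0 by norm_num) 0
  · exact Filter.Eventually.of_forall fun t => (Real.exp_pos _).le

lemma pi_complexGaussian_le_norm_sq {ι : Type*} [Fintype ι] {t : ℝ} (ht : 0 < t) :
    Measure.pi (fun _ : ι => complexGaussian) {z | t ≤ ‖z‖ ^ 2} =
      ENNReal.ofReal (1 - (1 - Real.exp (-t)) ^ Fintype.card ι) := by
  have h : {z : ι → ℂ | t ≤ ‖z‖ ^ 2} = (Set.univ.pi fun _ => Metric.ball 0 (√t))ᶜ := by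
    ext z
    have := pi_norm_lt_iff (x := z) (Real.sqrt_pos.2 ht)
    rw [Real.lt_sqrt (norm_nonneg z)] at this
    simp only [Set.mem_ofPred_eq, Set.mem_compl_iff, Set.mem_pi, Set.mem_univ, true_implies,
      mem_ball_zero_iff, ← this, not_lt]
  have he : 0 ≤ 1 - Real.exp (-t) := by
    rw [sub_nonneg, Real.exp_le_one_iff]; linarith
  rw [h, prob_compl_eq_one_sub (.univ_pi fun _ => measurableSet_ball), Measure.pi_pi]
  simp_rw [complexGaussian_ball ht.le]
  rw [Finset.prod_const, ← ENNReal.ofReal_pow he, ENNReal.ofReal_sub _ (pow_nonneg he _),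
    ENNReal.ofReal_one, Finset.card_univ]

lemma lintegral_sup_norm_sq_pi_complexGaussian :
    ∫⁻ z, ENNReal.ofReal (‖z‖ ^ 2) ∂(Measure.pi fun _ : Fin 4 => complexGaussian) =
      ENNReal.ofReal (25 / 12) := by
  have hi : ∀ k : ℝ, 0 < k → IntegrableOn (fun t : ℝ => Real.exp (-k * t)) (Set.Ioi 0) :=
    fun k hk => integrableOn_exp_mul_Ioi (neg_lt_zero.2 hk) 0
  have hv : ∀ k : ℝ, 0 < k → ∫ t in Set.Ioi (0 : ℝ), Real.exp (-k * t) = 1 / k := by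
    intro k hk
    rw [integral_exp_mul_Ioi (neg_lt_zero.2 hk)]
    simp
  have hexp : (fun t : ℝ => 1 - (1 - Real.exp (-t)) ^ Fintype.card (Fin 4)) = fun t =>
      4 * Real.exp (-1 * t) - 6 * Real.exp (-2 * t) + 4 * Real.exp (-3 * t)
        - Real.exp (-4 * t) := by
    funext t
    have h (k : ℕ) : Real.exp (-(k : ℝ) * t) = Real.exp (-t) ^ k := by
      rw [← Real.exp_nat_mul]; ring_nf
    have h1 := h 1; have h2 := h 2; have h3 := h 3; have h4 := h 4
    push_cast at h1 h2 h3 h4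
    rw [h1, h2, h3, h4, Fintype.card_fin]
    ring
  have i1 := (hi 1 (by norm_num)).const_mul 4
  have i2 := (hi 2 (by norm_num)).const_mul 6
  have i3 := (hi 3 (by norm_num)).const_mul 4
  have i4 := hi 4 (by norm_num)
  rw [lintegral_eq_lintegral_meas_le _ (Filter.Eventually.of_forall fun z => sq_nonneg ‖z‖)
      (by fun_prop),
    setLIntegral_congr_fun measurableSet_Ioi fun t ht => pi_complexGaussian_le_norm_sq ht,
    ← ofReal_integral_eq_lintegral_ofReal]
  · rw [hexp, integral_sub (by exact (i1.sub i2).add i3) i4,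
      integral_add (by exact i1.sub i2) i3, integral_sub i1 i2]
    simp_rw [integral_const_mul]
    rw [hv 1 (by norm_num), hv 2 (by norm_num), hv 3 (by norm_num), hv 4 (by norm_num)]
    norm_num
  · rw [hexp]
    exact ((i1.sub i2).add i3).sub i4
  · refine (ae_restrict_iff' measurableSet_Ioi).2 (Filter.Eventually.of_forall fun t ht => ?_)
    have h0 : 0 ≤ 1 - Real.exp (-t) := by
      rw [sub_nonneg, Real.exp_le_one_iff]; linarith [Set.mem_Ioi.1 ht]
    exact sub_nonneg.2 (pow_le_one₀ h0 (by linarith [Real.exp_pos (-t)]))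

lemma lintegral_sum_norm_sq_pi_complexGaussian {ι : Type*} [Fintype ι] :
    ∫⁻ z, ENNReal.ofReal (∑ i, ‖z i‖ ^ 2) ∂(Measure.pi fun _ : ι => complexGaussian) =
      Fintype.card ι := by
  simp_rw [ENNReal.ofReal_sum_of_nonneg fun i _ => sq_nonneg ‖(_ : ι → ℂ) i‖]
  rw [lintegral_finsetSum _ fun i _ => by fun_prop]
  have h (i : ι) : ∫⁻ z : ι → ℂ, ENNReal.ofReal (‖z i‖ ^ 2)
      ∂(Measure.pi fun _ : ι => complexGaussian) = 1 := by
    rw [← lintegral_norm_sq_complexGaussian,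
      ← (measurePreserving_eval (fun _ : ι => complexGaussian) i).lintegral_comp (by fun_prop)]
  rw [Finset.sum_congr rfl fun i _ => h i]
  simp

lemma pi_complexGaussian_eq_withDensity {ι : Type*} [Fintype ι] :
    Measure.pi (fun _ : ι => complexGaussian) =
      volume.withDensity fun z : ι → ℂ =>
        ENNReal.ofReal (∏ i, complexGaussianDensity (z i)) := by
  have hint : Integrable complexGaussianDensity := by
    refine ⟨continuous_complexGaussianDensity.aestronglyMeasurable, ?_⟩
    rw [hasFiniteIntegral_iff_ofReal (Filter.Eventually.of_forall complexGaussianDensity_nonneg),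
      ← setLIntegral_univ, ← withDensity_apply _ .univ]
    exact measure_lt_top complexGaussian _
  refine Measure.pi_eq fun s hs => ?_
  rw [withDensity_apply _ (.univ_pi hs), volume_pi, Measure.restrict_pi_pi,
    ← ofReal_integral_eq_lintegral_ofReal
      (Integrable.fintype_prod fun i => hint.restrict)
      (Filter.Eventually.of_forall fun z =>
        Finset.prod_nonneg fun i _ => complexGaussianDensity_nonneg _),
    integral_fintype_prod_eq_prod (fun _ => complexGaussianDensity),
    ENNReal.ofReal_prod_of_nonneg fun i _ => integral_nonneg complexGaussianDensity_nonneg]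
  refine Finset.prod_congr rfl fun i _ => ?_
  rw [complexGaussian, withDensity_apply _ (hs i), ofReal_integral_eq_lintegral_ofReal
    hint.restrict (Filter.Eventually.of_forall complexGaussianDensity_nonneg)]

lemma lintegral_inv_eq_self_of_isMulLeftInvariant {G : Type*} [Group G] [MeasurableSpace G]
    [MeasurableMul₂ G] [MeasurableInv G] (ν : Measure G) [IsProbabilityMeasure ν]
    [ν.IsMulLeftInvariant] {F : G → ENNReal} (hF : Measurable F) :
    ∫⁻ U, F U⁻¹ ∂ν = ∫⁻ U, F U ∂ν := by
  have h1 : ∫⁻ V, ∫⁻ U, F (V⁻¹ * U) ∂ν ∂ν = ∫⁻ U, F U ∂ν := by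
    simp [lintegral_mul_left_eq_self]
  have h2 : ∫⁻ U, ∫⁻ V, F (V⁻¹ * U) ∂ν ∂ν = ∫⁻ U, F U⁻¹ ∂ν := by
    have h (U : G) : ∫⁻ V, F (V⁻¹ * U) ∂ν = ∫⁻ V, F V⁻¹ ∂ν := by
      rw [← lintegral_mul_left_eq_self (fun V => F (V⁻¹ * U)) U]
      simp
    simp [h]
  rw [← h1, ← h2, lintegral_lintegral_swap]
  fun_prop

lemma sum_norm_sq_mulVec_of_mem_unitary {ι : Type*} [Fintype ι] [DecidableEq ι]
    (U : Matrix.unitaryGroup ι ℂ) (z : ι → ℂ) :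
    ∑ i, ‖((U : Matrix ι ι ℂ) *ᵥ z) i‖ ^ 2 = ∑ i, ‖z i‖ ^ 2 := by
  have h (w : ι → ℂ) : star w ⬝ᵥ w = ((∑ i, ‖w i‖ ^ 2 : ℝ) : ℂ) := by
    simp [dotProduct, Complex.conj_mul']
  have hU : star ((U : Matrix ι ι ℂ) *ᵥ z) ⬝ᵥ ((U : Matrix ι ι ℂ) *ᵥ z) = star z ⬝ᵥ z := by
    rw [star_mulVec, dotProduct_mulVec, vecMul_vecMul, ← star_eq_conjTranspose,
      Matrix.UnitaryGroup.star_mul_self, vecMul_one]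
  rw [h, h] at hU
  exact_mod_cast hU

lemma measurePreserving_mulVec_of_mem_unitary {ι : Type*} [Fintype ι] [DecidableEq ι]
    (U : Matrix.unitaryGroup ι ℂ) :
    MeasurePreserving (fun z : ι → ℂ => (U : Matrix ι ι ℂ) *ᵥ z) volume volume := by
  have hdet : LinearMap.det ((Matrix.toLin' (U : Matrix ι ι ℂ)).restrictScalars ℝ) = 1 := by
    rw [LinearMap.det_restrictScalars, LinearMap.det_toLin', Algebra.norm_complex_apply,
      Complex.normSq_eq_norm_sq]
    have h := Unitary.star_mul_self_of_mem (Matrix.det_of_mem_unitary U.2)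
    rw [Complex.star_def, Complex.conj_mul'] at h
    exact_mod_cast h
  have h := Measure.map_linearMap_addHaar_eq_smul_addHaar (volume : Measure (ι → ℂ))
    (f := (Matrix.toLin' (U : Matrix ι ι ℂ)).restrictScalars ℝ) (by rw [hdet]; exact one_ne_zero)
  rw [hdet] at h
  exact ⟨by fun_prop, by simpa using! h⟩

lemma exists_unitary_smul_mulVec_single {ι : Type*} [Fintype ι] [DecidableEq ι] (k : ι)
    (z : ι → ℂ) : ∃ W : Matrix.unitaryGroup ι ℂ,
      z = ((√(∑ i, ‖z i‖ ^ 2) : ℝ) : ℂ) • ((W : Matrix ι ι ℂ) *ᵥ Pi.single k 1) := by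
  by_cases hz : z = 0
  · exact ⟨1, by simp [hz]⟩
  set x : EuclideanSpace ℂ ι := WithLp.toLp 2 z with hx
  have hx0 : ‖x‖ ≠ 0 := by
    rw [norm_ne_zero_iff]
    intro h
    exact hz (by simpa [hx] using h)
  have hr : √(∑ i, ‖z i‖ ^ 2) = ‖x‖ := by rw [EuclideanSpace.norm_eq]
  have ho : Orthonormal ℂ (({k} : Set ι).domRestrict fun _ => ((‖x‖⁻¹ : ℝ) : ℂ) • x) := by
    constructor
    · intro i
      simp [norm_smul, hx0]
    · intro i j hij
      exact absurd (Subsingleton.elim i j) hij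
  obtain ⟨b, hb⟩ := ho.exists_orthonormalBasis_extension_of_card_eq (by simp)
  refine ⟨⟨_, (EuclideanSpace.basisFun ι ℂ).toMatrix_orthonormalBasis_mem_unitary b⟩, ?_⟩
  ext i
  have := hb k rfl
  simp only [mulVec_single_one, Pi.smul_apply, col_apply, Module.Basis.toMatrix_apply, this, hr]
  have hc : (‖x‖ : ℂ) ≠ 0 := by exact_mod_cast hx0
  simp only [EuclideanSpace.basisFun_toBasis, PiLp.basisFun_repr, PiLp.smul_apply, smul_eq_mul,
    Complex.ofReal_inv]
  rw [mul_inv_cancel_left₀ hc]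

lemma secondCountable_unitaryGroup {ι : Type*} [Fintype ι] [DecidableEq ι] :
    SecondCountableTopology (Matrix.unitaryGroup ι ℂ) :=
  haveI : SecondCountableTopology (Matrix ι ι ℂ) :=
    inferInstanceAs (SecondCountableTopology (ι → ι → ℂ))
  TopologicalSpace.Subtype.secondCountableTopology _

lemma measurePreserving_mulVec_pi_complexGaussian {ι : Type*} [Fintype ι] [DecidableEq ι]
    (U : Matrix.unitaryGroup ι ℂ) :
    MeasurePreserving (fun z : ι → ℂ => (U : Matrix ι ι ℂ) *ᵥ z)
      (Measure.pi fun _ => complexGaussian) (Measure.pi fun _ => complexGaussian) := by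
  have hU := measurePreserving_mulVec_of_mem_unitary U
  have hd (z : ι → ℂ) : ∏ i, complexGaussianDensity (z i) =
      Real.pi⁻¹ ^ Fintype.card ι * Real.exp (-∑ i, ‖z i‖ ^ 2) := by
    simp [complexGaussianDensity, Finset.prod_mul_distrib, ← Real.exp_sum]
  have hm : Measurable fun z : ι → ℂ =>
      ENNReal.ofReal (∏ i, complexGaussianDensity (z i)) := by
    simp_rw [hd]
    fun_prop
  refine ⟨hU.measurable, ?_⟩
  rw [pi_complexGaussian_eq_withDensity]
  ext s hs
  rw [Measure.map_apply hU.measurable hs, withDensity_apply _ (hU.measurable hs),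
    withDensity_apply _ hs, ← hU.setLIntegral_comp_preimage hs hm]
  simp_rw [hd, sum_norm_sq_mulVec_of_mem_unitary]

lemma lintegral_norm_sq_inv_mulVec {ι : Type*} [Fintype ι] [DecidableEq ι]
    [MeasurableSpace (Matrix.unitaryGroup ι ℂ)] [BorelSpace (Matrix.unitaryGroup ι ℂ)]
    (ν : Measure (Matrix.unitaryGroup ι ℂ)) [ν.IsMulLeftInvariant] [IsProbabilityMeasure ν]
    (k : ι) (z : ι → ℂ) :
    ∫⁻ U, ENNReal.ofReal (‖((U⁻¹ : Matrix.unitaryGroup ι ℂ) : Matrix ι ι ℂ) *ᵥ z‖ ^ 2) ∂ν =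
      ENNReal.ofReal (∑ i, ‖z i‖ ^ 2) *
        ∫⁻ U, ENNReal.ofReal (‖(U : Matrix ι ι ℂ) *ᵥ Pi.single k 1‖ ^ 2) ∂ν := by
  have := secondCountable_unitaryGroup (ι := ι)
  obtain ⟨W, hW⟩ := exists_unitary_smul_mulVec_single k z
  have h0 : 0 ≤ ∑ i, ‖z i‖ ^ 2 := Finset.sum_nonneg fun i _ => sq_nonneg _
  set F : Matrix.unitaryGroup ι ℂ → ENNReal := fun U =>
    ENNReal.ofReal (‖(U : Matrix ι ι ℂ) *ᵥ Pi.single k 1‖ ^ 2) with hF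
  have hFm : Measurable F := by
    have : Continuous fun U : Matrix.unitaryGroup ι ℂ =>
      ‖(U : Matrix ι ι ℂ) *ᵥ (Pi.single k 1 : ι → ℂ)‖ ^ 2 := by fun_prop
    exact this.measurable.ennreal_ofReal
  have hU (U : Matrix.unitaryGroup ι ℂ) :
      ENNReal.ofReal (‖((U⁻¹ : Matrix.unitaryGroup ι ℂ) : Matrix ι ι ℂ) *ᵥ z‖ ^ 2) =
        ENNReal.ofReal (∑ i, ‖z i‖ ^ 2) * F (W⁻¹ * U)⁻¹ := by
    rw [hF, ← ENNReal.ofReal_mul h0, _root_.mul_inv_rev, inv_inv]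
    congr 1
    conv_lhs => rw [hW]
    rw [mulVec_smul, mulVec_mulVec, norm_smul, mul_pow, Complex.norm_real, Real.norm_eq_abs,
      sq_abs, Real.sq_sqrt h0]
    rfl
  simp_rw [hU]
  rw [lintegral_const_mul _ (by fun_prop), lintegral_mul_left_eq_self (fun U => F U⁻¹) W⁻¹,
    lintegral_inv_eq_self_of_isMulLeftInvariant ν hFm]

lemma lintegral_norm_sq_unitary_column
    [MeasurableSpace (Matrix.unitaryGroup (Fin 4) ℂ)] [BorelSpace (Matrix.unitaryGroup (Fin 4) ℂ)]
    (ν : Measure (Matrix.unitaryGroup (Fin 4) ℂ)) [ν.IsMulLeftInvariant]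
    [IsProbabilityMeasure ν] (k : Fin 4) :
    ∫⁻ U, ENNReal.ofReal (‖(U : Matrix (Fin 4) (Fin 4) ℂ) *ᵥ Pi.single k 1‖ ^ 2) ∂ν =
      ENNReal.ofReal (25 / 48) := by
  have := secondCountable_unitaryGroup (ι := Fin 4)
  set μ : Measure (Fin 4 → ℂ) := Measure.pi fun _ => complexGaussian with hμ
  have hcont : Continuous fun p : Matrix.unitaryGroup (Fin 4) ℂ × (Fin 4 → ℂ) =>
      ‖((p.1⁻¹ : Matrix.unitaryGroup (Fin 4) ℂ) : Matrix (Fin 4) (Fin 4) ℂ) *ᵥ p.2‖ ^ 2 := by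
    fun_prop
  have h1 (U : Matrix.unitaryGroup (Fin 4) ℂ) :
      ∫⁻ z, ENNReal.ofReal (‖((U⁻¹ : Matrix.unitaryGroup (Fin 4) ℂ) :
        Matrix (Fin 4) (Fin 4) ℂ) *ᵥ z‖ ^ 2) ∂μ = ENNReal.ofReal (25 / 12) := by
    rw [← lintegral_sup_norm_sq_pi_complexGaussian]
    exact (measurePreserving_mulVec_pi_complexGaussian U⁻¹).lintegral_comp
      (f := fun z => ENNReal.ofReal (‖z‖ ^ 2)) (by fun_prop)
  have h2 := lintegral_lintegral_swap (μ := ν) (ν := μ)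
    (f := fun U z => ENNReal.ofReal (‖((U⁻¹ : Matrix.unitaryGroup (Fin 4) ℂ) :
      Matrix (Fin 4) (Fin 4) ℂ) *ᵥ z‖ ^ 2)) hcont.measurable.ennreal_ofReal.aemeasurable
  simp_rw [h1, lintegral_norm_sq_inv_mulVec ν k] at h2
  rw [lintegral_mul_const _ (by fun_prop), lintegral_sum_norm_sq_pi_complexGaussian,
    lintegral_const, measure_univ, mul_one, Fintype.card_fin] at h2
  refine (ENNReal.mul_right_inj (a := ((4 : ℕ) : ENNReal)) (by simp) (by simp)).1 ?_
  rw [← h2, ← ENNReal.ofReal_natCast, ← ENNReal.ofReal_mul (by positivity)]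
  norm_num

lemma integral_norm_sq_unitary_column
    [MeasurableSpace (Matrix.unitaryGroup (Fin 4) ℂ)] [BorelSpace (Matrix.unitaryGroup (Fin 4) ℂ)]
    (ν : Measure (Matrix.unitaryGroup (Fin 4) ℂ)) [ν.IsMulLeftInvariant]
    [IsProbabilityMeasure ν] (k : Fin 4) :
    ∫ U, ‖(U : Matrix (Fin 4) (Fin 4) ℂ) *ᵥ (Pi.single k 1 : Fin 4 → ℂ)‖ ^ 2 ∂ν = 25 / 48 := by
  have := secondCountable_unitaryGroup (ι := Fin 4)
  have hcont : Continuous fun U : Matrix.unitaryGroup (Fin 4) ℂ =>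
      ‖(U : Matrix (Fin 4) (Fin 4) ℂ) *ᵥ (Pi.single k 1 : Fin 4 → ℂ)‖ ^ 2 := by fun_prop
  rw [integral_eq_lintegral_of_nonneg_ae (Filter.Eventually.of_forall fun U => sq_nonneg _)
      hcont.aestronglyMeasurable, lintegral_norm_sq_unitary_column ν k,
    ENNReal.toReal_ofReal (by norm_num)]

lemma sup'_norm_sq_productStateAmp (m : ℕ) (V : Fin m → Matrix.unitaryGroup (Fin 4) ℂ) :
    (Finset.univ.sup' Finset.univ_nonempty
      fun s : Fin (2 * m) → Fin 2 => ‖productStateAmp m V s‖ ^ 2) =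
      ∏ i, ‖(V i : Matrix (Fin 4) (Fin 4) ℂ) *ᵥ (Pi.single 0 1 : Fin 4 → ℂ)‖ ^ 2 := by
  rw [Finset.prod_pow]
  refine le_antisymm (Finset.sup'_le _ _ fun s _ => ?_) ?_
  · rw [productStateAmp, norm_prod]
    gcongr
    exact norm_le_pi_norm _ _
  · have hmax (i : Fin m) : ∃ k, ‖((V i : Matrix (Fin 4) (Fin 4) ℂ) *ᵥ
        (Pi.single 0 1 : Fin 4 → ℂ)) k‖ =
        ‖(V i : Matrix (Fin 4) (Fin 4) ℂ) *ᵥ (Pi.single 0 1 : Fin 4 → ℂ)‖ := by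
      obtain ⟨k, hk⟩ := Finite.exists_max fun k =>
        ‖((V i : Matrix (Fin 4) (Fin 4) ℂ) *ᵥ (Pi.single 0 1 : Fin 4 → ℂ)) k‖
      exact ⟨k, le_antisymm (norm_le_pi_norm _ k) ((pi_norm_le_iff_of_nonempty _).2 hk)⟩
    choose k hk using hmax
    let s : Fin (2 * m) → Fin 2 := fun j =>
      if j.val % 2 = 0 then ⟨(k ⟨j.val / 2, by omega⟩).val / 2, by omega⟩
      else ⟨(k ⟨j.val / 2, by omega⟩).val % 2, by omega⟩
    refine Finset.le_sup'_of_le _ (Finset.mem_univ s) ?_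
    rw [productStateAmp, norm_prod]
    refine le_of_eq ?_
    congr 1
    refine Finset.prod_congr rfl fun i _ => ?_
    rw [← hk i]
    congr 2
    ext
    have h2 : (2 * i.val + 1) / 2 = i.val := by omega
    simp only [s, Nat.mul_mod_right, if_true, Nat.mul_add_mod_self_left, h2,
      Nat.mul_div_cancel_left i.val two_pos, Nat.one_mod, one_ne_zero, if_false]
    exact (Nat.div_add_mod _ 2).symm

/-- **Expected peak weight of one layer of random two-qubit gates.**
Let `n = 2m` be an even positive integer and let `V₁, …, V_m` be independent
Haar-random elements of `U(4)` (i.e. distributed according to the product of Haar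
probability measures `ν`).  Then the expected peak weight over the computational basis
of `Ψ = (V₁ ⊗ ⋯ ⊗ V_m)|0^n⟩` equals `(25/48)^(n/2)`. -/
theorem expected_peak_weight_one_random_layer
    (n m : ℕ) (hn : 0 < n) (hnm : n = 2 * m)
    [MeasurableSpace (Matrix.unitaryGroup (Fin 4) ℂ)]
    [BorelSpace (Matrix.unitaryGroup (Fin 4) ℂ)]
    (ν : Measure (Matrix.unitaryGroup (Fin 4) ℂ))
    [ν.IsHaarMeasure] [IsProbabilityMeasure ν] :
    ∫ V, (Finset.univ.sup' Finset.univ_nonempty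
        fun s : Fin (2 * m) → Fin 2 => ‖productStateAmp m V s‖ ^ 2)
      ∂(Measure.pi fun _ : Fin m => ν) = (25 / 48 : ℝ) ^ m := by
  simp_rw [sup'_norm_sq_productStateAmp]
  rw [integral_fintype_prod_eq_pow (fun U : Matrix.unitaryGroup (Fin 4) ℂ =>
      ‖(U : Matrix (Fin 4) (Fin 4) ℂ) *ᵥ (Pi.single 0 1 : Fin 4 → ℂ)‖ ^ 2),
    integral_norm_sq_unitary_column ν 0, Fintype.card_fin]
end

section
/- Let n be an even positive integer and m = n/2. Let V₁, …, V_m be independent Haar-random elements of U(4); for each i let ψ_i = V_i e₀ ∈ ℂ⁴, let M_i be its 2×2 reshaping (M_i)_{a,b} = (ψ_i)_{2a+b}, and let λ_i be the largest eigenvalue of M_i M_i†. Then E[ ∏_{i=1}^{m} λ_i ] = (7/8)^{n/2}. Consequently, the expected optimal peak weight achievable by appending one layer of single-qubit unitaries to the random product state (V₁ ⊗ … ⊗ V_m)|0^n⟩, namely E[ sup_{W₁,…,W_n ∈ U(2)} max_{s ∈ {0,1}^n} |⟨s|(⊗_j W_j)(⊗_i V_i)|0^n⟩|² ], equals (7/8)^{n/2},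 which exceeds the expected peak weight (25/48)^{n/2} of the unrotated state. -/
open Matrix MeasureTheory

/-- The `2×2` reshaping `M` of a two-qubit vector `ψ ∈ ℂ⁴`, with `M i j = ψ (2i + j)`. -/
def reshape2 (ψ : Fin 4 → ℂ) : Matrix (Fin 2) (Fin 2) ℂ :=
  Matrix.of fun i j : Fin 2 =>
    ψ ⟨2 * i.val + j.val, by have := i.isLt; have := j.isLt; omega⟩

/-- The largest eigenvalue of a Hermitian `2×2` complex matrix. -/
noncomputable def lambdaMax (A : Matrix (Fin 2) (Fin 2) ℂ) (hA : A.IsHermitian) : ℝ :=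
  Finset.univ.sup' Finset.univ_nonempty hA.eigenvalues

/-- The largest squared Schmidt coefficient of the two-qubit state `V|00⟩`,
for `V ∈ U(4)`: the largest eigenvalue of `M Mᴴ` where `M` is the reshaping of `V e₀`. -/
noncomputable def largestSchmidtWeight (V : Matrix.unitaryGroup (Fin 4) ℂ) : ℝ :=
  lambdaMax
    (reshape2 ((V : Matrix (Fin 4) (Fin 4) ℂ) *ᵥ (Pi.single 0 1 : Fin 4 → ℂ)) *
      (reshape2 ((V : Matrix (Fin 4) (Fin 4) ℂ) *ᵥ (Pi.single 0 1 : Fin 4 → ℂ)))ᴴ)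
    (Matrix.isHermitian_mul_conjTranspose_self _)

/-- The computational-basis amplitude `⟨s|(W₁ ⊗ ⋯ ⊗ W_{2m})(V₁ ⊗ ⋯ ⊗ V_m)|0^{2m}⟩`,
where each `V i ∈ U(4)` acts on the qubit pair `(2i, 2i+1)`, each `W j ∈ U(2)` acts on
qubit `j`, and `s : Fin (2m) → Fin 2` is a bit string. -/
noncomputable def rotatedAmp (m : ℕ) (V : Fin m → Matrix.unitaryGroup (Fin 4) ℂ)
    (W : Fin (2 * m) → Matrix.unitaryGroup (Fin 2) ℂ) (s : Fin (2 * m) → Fin 2) : ℂ :=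
  ∏ i : Fin m, ∑ c : Fin 2, ∑ d : Fin 2,
    (W ⟨2 * i.val, by omega⟩ : Matrix (Fin 2) (Fin 2) ℂ) (s ⟨2 * i.val, by omega⟩) c *
      (W ⟨2 * i.val + 1, by omega⟩ : Matrix (Fin 2) (Fin 2) ℂ)
        (s ⟨2 * i.val + 1, by omega⟩) d *
      ((V i : Matrix (Fin 4) (Fin 4) ℂ) *ᵥ (Pi.single 0 1 : Fin 4 → ℂ))
        ⟨2 * c.val + d.val, by have := c.isLt; have := d.isLt; omega⟩

theorem integral_norm_pow_mul_exp_neg_norm_sq (d : ℕ) [NeZero d] (k : ℕ) :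
    ∫ x : EuclideanSpace ℝ (Fin d), ‖x‖ ^ k * Real.exp (-‖x‖ ^ 2) =
      √Real.pi ^ d * Real.Gamma ((d + k) / 2) / Real.Gamma (d / 2) := by
  have hd : 1 ≤ d := NeZero.one_le
  have hd0 : (0 : ℝ) < d := by exact_mod_cast hd
  have hball : volume.real (Metric.ball (0 : EuclideanSpace ℝ (Fin d)) 1) =
      √Real.pi ^ d / (d / 2 * Real.Gamma (d / 2)) := by
    have : 0 < Real.Gamma (d / 2) := Real.Gamma_pos_of_pos (by positivity)
    rw [Measure.real, EuclideanSpace.volume_ball, Fintype.card_fin,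
      Real.Gamma_add_one (by positivity), ENNReal.ofReal_one, one_pow, one_mul,
      ENNReal.toReal_ofReal (by positivity)]
  have hradial : ∫ y in Set.Ioi (0 : ℝ),
      y ^ (Module.finrank ℝ (EuclideanSpace ℝ (Fin d)) - 1) • (y ^ k * Real.exp (-y ^ 2)) =
        Real.Gamma ((d + k) / 2) / 2 := by
    calc _ = ∫ y in Set.Ioi (0 : ℝ), y ^ ((d - 1 + k : ℕ) : ℝ) * Real.exp (-y ^ (2 : ℝ)) := by
          refine setIntegral_congr_fun measurableSet_Ioi fun y _ => ?_
          rw [Real.rpow_natCast, Real.rpow_two, pow_add, finrank_euclideanSpace, Fintype.card_fin,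
            smul_eq_mul, mul_assoc]
      _ = _ := integral_rpow_mul_exp_neg_rpow (by norm_num)
          (neg_one_lt_zero.trans_le (Nat.cast_nonneg _))
      _ = _ := by
        push_cast [Nat.cast_sub hd]
        ring_nf
  have : 0 < Real.Gamma (d / 2) := Real.Gamma_pos_of_pos (by positivity)
  rw [integral_fun_norm_addHaar volume (fun r => r ^ k * Real.exp (-r ^ 2)), hradial, hball]
  simp only [finrank_euclideanSpace, Fintype.card_fin, nsmul_eq_mul, smul_eq_mul]
  field_simp

theorem integrable_norm_pow_mul_exp_neg_norm_sq (d : ℕ) [NeZero d] (k : ℕ) :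
    Integrable fun x : EuclideanSpace ℝ (Fin d) => ‖x‖ ^ k * Real.exp (-‖x‖ ^ 2) := by
  have hd0 : (0 : ℝ) < d := by exact_mod_cast (NeZero.one_le : 1 ≤ d)
  refine .of_integral_ne_zero ?_
  rw [integral_norm_pow_mul_exp_neg_norm_sq]
  have := Real.Gamma_pos_of_pos (half_pos hd0)
  have := Real.Gamma_pos_of_pos (s := (d + k) / 2) (by positivity)
  positivity

/-- Gaussian integral of the norm of the component orthogonal to the first coordinate axis. -/
theorem integral_sqrt_norm_sq_sub_sq_mul_exp (d : ℕ) :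
    ∫ y : EuclideanSpace ℝ (Fin (d + 1)), √(‖y‖ ^ 2 - y 0 ^ 2) * Real.exp (-‖y‖ ^ 2) =
      √Real.pi * ∫ z : EuclideanSpace ℝ (Fin d), ‖z‖ * Real.exp (-‖z‖ ^ 2) := by
  rw [← (PiLp.volume_preserving_toLp (Fin (d + 1))).integral_comp
      (MeasurableEquiv.toLp 2 _).measurableEmbedding,
    ← (PiLp.volume_preserving_toLp (Fin d)).integral_comp
      (MeasurableEquiv.toLp 2 _).measurableEmbedding,
    ← (volume_preserving_piFinSuccAbove (fun _ : Fin (d + 1) => ℝ) 0).symm.integral_comp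
      (MeasurableEquiv.measurableEmbedding _)]
  have hg : ∫ t : ℝ, Real.exp (-t ^ 2) = √Real.pi := by
    simpa using integral_gaussian 1
  rw [← hg, ← integral_prod_mul]
  refine integral_congr_ae (.of_forall fun p => ?_)
  have hcons : ‖WithLp.toLp 2 (Fin.insertNthEquiv (fun _ : Fin (d + 1) => ℝ) 0 p)‖ ^ 2 =
      p.1 ^ 2 + ‖WithLp.toLp 2 p.2‖ ^ 2 := by
    simp [EuclideanSpace.norm_sq_eq, Fin.sum_univ_succ]
  simp only [MeasurableEquiv.piFinSuccAbove_symm_apply, hcons, Fin.insertNthEquiv_apply,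
    Fin.insertNth_zero', Fin.cons_zero, add_sub_cancel_left, neg_add, Real.exp_add,
    Real.sqrt_sq (norm_nonneg _)]
  ring

/-- Gaussian integral of the area of the parallelogram spanned by a fixed `x` and a Gaussian `y`. -/
theorem integral_sqrt_gram_mul_exp (d : ℕ) (x : EuclideanSpace ℝ (Fin (d + 1))) :
    ∫ y : EuclideanSpace ℝ (Fin (d + 1)),
        √(‖x‖ ^ 2 * ‖y‖ ^ 2 - inner ℝ x y ^ 2) * Real.exp (-‖y‖ ^ 2) =
      ‖x‖ * (√Real.pi * ∫ z : EuclideanSpace ℝ (Fin d), ‖z‖ * Real.exp (-‖z‖ ^ 2)) := by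
  let b : EuclideanSpace ℝ (Fin (d + 1)) := EuclideanSpace.single 0 ‖x‖
  have hb : ‖x‖ = ‖b‖ := by simp [b]
  let R := (ℝ ∙ (x - b))ᗮ.reflection
  have hR : R x = b := Submodule.reflection_sub hb
  rw [← integral_sqrt_norm_sq_sub_sq_mul_exp, ← integral_const_mul,
    ← R.measurePreserving.integral_comp R.toHomeomorph.measurableEmbedding]
  refine integral_congr_ae (.of_forall fun y => ?_)
  have h0 : inner ℝ x (R y) = ‖x‖ * y 0 := by
    rw [← R.inner_map_map, hR, Submodule.reflection_reflection]
    simp [b, EuclideanSpace.inner_single_left]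
  simp only [h0, R.norm_map]
  rw [mul_pow, ← mul_sub, Real.sqrt_mul (sq_nonneg _), Real.sqrt_sq (norm_nonneg _), mul_assoc]

/-- The difference of the two squared singular values of the `2×2` reshaping of `w`. -/
noncomputable def schmidtGap (w : Fin 4 → ℂ) : ℝ :=
  √((∑ i, ‖w i‖ ^ 2) ^ 2 - 4 * ‖w 0 * w 3 - w 1 * w 2‖ ^ 2)

/-- The magic-basis coordinates on `ℂ⁴`, scaled by `√2`. -/
noncomputable def magicMap :
    EuclideanSpace ℝ (Fin 4) × EuclideanSpace ℝ (Fin 4) →ₗ[ℝ] (Fin 4 → ℂ) where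
  toFun p := ![⟨p.1 0 - p.2 1, p.2 0 + p.1 1⟩, ⟨p.1 3 - p.2 2, p.2 3 + p.1 2⟩,
    ⟨-p.1 3 - p.2 2, -p.2 3 + p.1 2⟩, ⟨p.1 0 + p.2 1, p.2 0 - p.1 1⟩]
  map_add' p q := by
    ext i
    fin_cases i <;> apply Complex.ext <;> simp <;> ring
  map_smul' c p := by
    ext i
    fin_cases i <;> apply Complex.ext <;> simp <;> ring

theorem sum_norm_sq_magicMap (p : EuclideanSpace ℝ (Fin 4) × EuclideanSpace ℝ (Fin 4)) :
    ∑ i, ‖magicMap p i‖ ^ 2 = 2 * (‖p.1‖ ^ 2 + ‖p.2‖ ^ 2) := by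
  simp [magicMap, Fin.sum_univ_four, EuclideanSpace.norm_sq_eq, ← Complex.normSq_eq_norm_sq,
    Complex.normSq_apply]
  ring

theorem schmidtGap_magicMap (p : EuclideanSpace ℝ (Fin 4) × EuclideanSpace ℝ (Fin 4)) :
    schmidtGap (magicMap p) = 4 * √(‖p.1‖ ^ 2 * ‖p.2‖ ^ 2 - inner ℝ p.1 p.2 ^ 2) := by
  have h16 : (4 : ℝ) = √16 := by
    rw [show (16 : ℝ) = 4 ^ 2 by norm_num, Real.sqrt_sq (by norm_num)]
  rw [h16, ← Real.sqrt_mul (by norm_num), schmidtGap, sum_norm_sq_magicMap]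
  congr 1
  simp [magicMap, EuclideanSpace.norm_sq_eq, Fin.sum_univ_four, ← Complex.normSq_eq_norm_sq,
    Complex.normSq_apply, PiLp.inner_apply]
  ring

theorem magicMap_injective : Function.Injective magicMap := by
  refine (injective_iff_map_eq_zero _).2 fun p hp => ?_
  have h := sum_norm_sq_magicMap p
  rw [hp] at h
  simp only [Pi.zero_apply, norm_zero, ne_eq, OfNat.ofNat_ne_zero, not_false_eq_true, zero_pow,
    Finset.sum_const_zero] at h
  have h1 := sq_nonneg ‖p.1‖
  have h2 := sq_nonneg ‖p.2‖
  refine Prod.ext (norm_eq_zero.1 (pow_eq_zero_iff two_ne_zero |>.1 ?_))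
    (norm_eq_zero.1 (pow_eq_zero_iff two_ne_zero |>.1 ?_)) <;> linarith

theorem schmidtGap_nonneg (w : Fin 4 → ℂ) : 0 ≤ schmidtGap w := Real.sqrt_nonneg _

theorem schmidtGap_le (w : Fin 4 → ℂ) : schmidtGap w ≤ ∑ i, ‖w i‖ ^ 2 := by
  rw [schmidtGap]
  refine Real.sqrt_le_iff.2 ⟨by positivity, ?_⟩
  have := sq_nonneg ‖w 0 * w 3 - w 1 * w 2‖
  linarith

theorem schmidtGap_smul (c : ℝ) (w : Fin 4 → ℂ) : schmidtGap (c • w) = c ^ 2 * schmidtGap w := by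
  have h : (c • w) 0 * (c • w) 3 - (c • w) 1 * (c • w) 2 =
      (c ^ 2 : ℂ) * (w 0 * w 3 - w 1 * w 2) := by
    simp
    ring
  have h2 : (∑ i, ‖(c • w) i‖ ^ 2) ^ 2 - 4 * ‖(c ^ 2 : ℂ) * (w 0 * w 3 - w 1 * w 2)‖ ^ 2 =
      (c ^ 2) ^ 2 * ((∑ i, ‖w i‖ ^ 2) ^ 2 - 4 * ‖w 0 * w 3 - w 1 * w 2‖ ^ 2) := by
    simp [mul_pow, ← Finset.mul_sum]
    ring
  rw [schmidtGap, h, h2, Real.sqrt_mul (by positivity), Real.sqrt_sq (sq_nonneg c), schmidtGap]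

theorem continuous_schmidtGap : Continuous schmidtGap := by
  unfold schmidtGap
  fun_prop

/-- Pushforward of Lebesgue measure under the magic-basis coordinates. -/
noncomputable def magicMeasure : Measure (Fin 4 → ℂ) := Measure.map magicMap volume

theorem measurableEmbedding_magicMap : MeasurableEmbedding magicMap :=
  (magicMap.isClosedEmbedding_of_injective
    (LinearMap.ker_eq_bot.2 magicMap_injective)).measurableEmbedding

instance : magicMeasure.IsAddHaarMeasure := by
  have hdim : Module.finrank ℝ (EuclideanSpace ℝ (Fin 4) × EuclideanSpace ℝ (Fin 4)) =
      Module.finrank ℝ (Fin 4 → ℂ) := by simp [Module.finrank_pi_fintype]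
  have : (volume : Measure (EuclideanSpace ℝ (Fin 4) × EuclideanSpace ℝ (Fin 4))).IsAddHaarMeasure :=
    inferInstanceAs (Measure.prod volume volume).IsAddHaarMeasure
  exact ((LinearMap.linearEquivOfInjective magicMap magicMap_injective
    hdim).toContinuousLinearEquiv).isAddHaarMeasure_map volume

theorem integral_magicMeasure (f : (Fin 4 → ℂ) → ℝ) :
    ∫ w, f w ∂magicMeasure = ∫ p, f (magicMap p) :=
  measurableEmbedding_magicMap.integral_map f

/-- The Gaussian weight on `ℂ⁴`. -/
noncomputable def gaussWeight (w : Fin 4 → ℂ) : ℝ := Real.exp (-(∑ i, ‖w i‖ ^ 2) / 2)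

theorem gaussWeight_nonneg (w : Fin 4 → ℂ) : 0 ≤ gaussWeight w := Real.exp_nonneg _

theorem continuous_gaussWeight : Continuous gaussWeight := by
  unfold gaussWeight
  fun_prop

theorem gaussWeight_magicMap (p : EuclideanSpace ℝ (Fin 4) × EuclideanSpace ℝ (Fin 4)) :
    gaussWeight (magicMap p) = Real.exp (-‖p.1‖ ^ 2) * Real.exp (-‖p.2‖ ^ 2) := by
  rw [gaussWeight, sum_norm_sq_magicMap, ← Real.exp_add]
  ring_nf

theorem integrable_normSq_mul_gaussWeight :
    Integrable (fun w => (∑ i, ‖w i‖ ^ 2) * gaussWeight w) magicMeasure := by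
  rw [magicMeasure, measurableEmbedding_magicMap.integrable_map_iff]
  have h0 := integrable_norm_pow_mul_exp_neg_norm_sq 4 0
  have h2 := integrable_norm_pow_mul_exp_neg_norm_sq 4 2
  refine (((h2.mul_prod h0).add (h0.mul_prod h2)).const_mul 2).congr (.of_forall fun p => ?_)
  simp [gaussWeight_magicMap, sum_norm_sq_magicMap]
  ring

theorem integral_normSq_mul_gaussWeight :
    ∫ w, (∑ i, ‖w i‖ ^ 2) * gaussWeight w ∂magicMeasure = 8 * Real.pi ^ 4 := by
  have h0 := integrable_norm_pow_mul_exp_neg_norm_sq 4 0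
  have h2 := integrable_norm_pow_mul_exp_neg_norm_sq 4 2
  have e0 := integral_norm_pow_mul_exp_neg_norm_sq 4 0
  have e2 := integral_norm_pow_mul_exp_neg_norm_sq 4 2
  calc _ = ∫ p : EuclideanSpace ℝ (Fin 4) × EuclideanSpace ℝ (Fin 4),
        2 * ((‖p.1‖ ^ 2 * Real.exp (-‖p.1‖ ^ 2)) * (‖p.2‖ ^ 0 * Real.exp (-‖p.2‖ ^ 2)) +
          (‖p.1‖ ^ 0 * Real.exp (-‖p.1‖ ^ 2)) * (‖p.2‖ ^ 2 * Real.exp (-‖p.2‖ ^ 2))) := by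
        rw [integral_magicMeasure]
        refine integral_congr_ae (.of_forall fun p => ?_)
        simp [gaussWeight_magicMap, sum_norm_sq_magicMap]
        ring
    _ = _ := by
      rw [integral_const_mul, Measure.volume_eq_prod,
        integral_add (h2.mul_prod h0) (h0.mul_prod h2),
        integral_prod_mul (fun x : EuclideanSpace ℝ (Fin 4) => ‖x‖ ^ 2 * Real.exp (-‖x‖ ^ 2))
          (fun x : EuclideanSpace ℝ (Fin 4) => ‖x‖ ^ 0 * Real.exp (-‖x‖ ^ 2)),
        integral_prod_mul (fun x : EuclideanSpace ℝ (Fin 4) => ‖x‖ ^ 0 * Real.exp (-‖x‖ ^ 2))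
          (fun x : EuclideanSpace ℝ (Fin 4) => ‖x‖ ^ 2 * Real.exp (-‖x‖ ^ 2)), e0, e2]
      have hp : √Real.pi ^ 4 = Real.pi ^ 2 := by
        rw [show 4 = 2 * 2 by norm_num, pow_mul, Real.sq_sqrt Real.pi_nonneg]
      have g3 : Real.Gamma (((4 : ℕ) + (2 : ℕ) : ℝ) / 2) = 2 := by
        rw [show (((4 : ℕ) + (2 : ℕ) : ℝ) / 2) = (2 : ℕ) + 1 by norm_num,
          Real.Gamma_nat_eq_factorial]
        simp
      have g2 : Real.Gamma (((4 : ℕ) : ℝ) / 2) = 1 := by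
        rw [show (((4 : ℕ) : ℝ) / 2) = 2 by norm_num, Real.Gamma_two]
      rw [Nat.cast_zero, add_zero, g2, g3, hp]
      ring

theorem integrable_schmidtGap_mul_gaussWeight :
    Integrable (fun w => schmidtGap w * gaussWeight w) magicMeasure := by
  refine integrable_normSq_mul_gaussWeight.mono' ?_ (.of_forall fun w => ?_)
  · exact (continuous_schmidtGap.mul continuous_gaussWeight).aestronglyMeasurable
  · rw [Real.norm_of_nonneg (mul_nonneg (schmidtGap_nonneg w) (gaussWeight_nonneg w))]
    exact mul_le_mul_of_nonneg_right (schmidtGap_le w) (gaussWeight_nonneg w)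

theorem integral_schmidtGap_mul_gaussWeight :
    ∫ w, schmidtGap w * gaussWeight w ∂magicMeasure = 6 * Real.pi ^ 4 := by
  have hint := integrable_schmidtGap_mul_gaussWeight
  rw [magicMeasure, measurableEmbedding_magicMap.integrable_map_iff, Measure.volume_eq_prod,
    Function.comp_def] at hint
  have e3 := integral_norm_pow_mul_exp_neg_norm_sq 3 1
  have e4 := integral_norm_pow_mul_exp_neg_norm_sq 4 1
  simp only [pow_one] at e3 e4
  rw [integral_magicMeasure, Measure.volume_eq_prod, integral_prod _ hint]
  have hinner (x : EuclideanSpace ℝ (Fin 4)) :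
      ∫ y : EuclideanSpace ℝ (Fin 4),
          schmidtGap (magicMap (x, y)) * gaussWeight (magicMap (x, y)) =
        4 * (√Real.pi * ∫ z : EuclideanSpace ℝ (Fin 3), ‖z‖ * Real.exp (-‖z‖ ^ 2)) *
          (‖x‖ * Real.exp (-‖x‖ ^ 2)) := by
    calc _ = ∫ y : EuclideanSpace ℝ (Fin 4), (4 * Real.exp (-‖x‖ ^ 2)) *
          (√(‖x‖ ^ 2 * ‖y‖ ^ 2 - inner ℝ x y ^ 2) * Real.exp (-‖y‖ ^ 2)) := by
          refine integral_congr_ae (.of_forall fun y => ?_)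
          simp only [schmidtGap_magicMap, gaussWeight_magicMap]
          ring
      _ = _ := by
        rw [integral_const_mul, integral_sqrt_gram_mul_exp]
        ring
  simp only [hinner]
  rw [integral_const_mul, e3, e4]
  have hp : √Real.pi ^ 2 = Real.pi := Real.sq_sqrt Real.pi_nonneg
  have h32 : Real.Gamma ((3 : ℕ) / 2) = √Real.pi / 2 := by
    rw [show (((3 : ℕ) : ℝ) / 2) = 1 / 2 + 1 by norm_num, Real.Gamma_add_one (by norm_num),
      Real.Gamma_one_half_eq]
    ring
  have h52 : Real.Gamma (((4 : ℕ) + (1 : ℕ)) / 2) = 3 / 4 * √Real.pi := by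
    rw [show (((4 : ℕ) + (1 : ℕ) : ℝ) / 2) = (1 / 2 + 1) + 1 by norm_num,
      Real.Gamma_add_one (by norm_num), Real.Gamma_add_one (by norm_num), Real.Gamma_one_half_eq]
    ring
  have h42 : Real.Gamma (((4 : ℕ) : ℝ) / 2) = 1 := by
    rw [show (((4 : ℕ) : ℝ) / 2) = 2 by norm_num, Real.Gamma_two]
  have h31 : Real.Gamma (((3 : ℕ) + (1 : ℕ) : ℝ) / 2) = 1 := by
    rw [show (((3 : ℕ) + (1 : ℕ) : ℝ) / 2) = 2 by norm_num, Real.Gamma_two]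
  have hs : √Real.pi ≠ 0 := (Real.sqrt_pos.2 Real.pi_pos).ne'
  rw [h32, h52, h42, h31]
  nth_rewrite 6 [← hp]
  field_simp
  norm_num

theorem sum_norm_sq_mulVec (V : Matrix.unitaryGroup (Fin 4) ℂ) (w : Fin 4 → ℂ) :
    ∑ i, ‖((V : Matrix (Fin 4) (Fin 4) ℂ) *ᵥ w) i‖ ^ 2 = ∑ i, ‖w i‖ ^ 2 := by
  have key (v : Fin 4 → ℂ) : star v ⬝ᵥ v = ((∑ i, ‖v i‖ ^ 2 : ℝ) : ℂ) := by
    simp [dotProduct, Complex.conj_mul']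
  have h : star ((V : Matrix (Fin 4) (Fin 4) ℂ) *ᵥ w) ⬝ᵥ ((V : Matrix (Fin 4) (Fin 4) ℂ) *ᵥ w) =
      star w ⬝ᵥ w := by
    rw [star_mulVec, ← dotProduct_mulVec, mulVec_mulVec, ← star_eq_conjTranspose,
      UnitaryGroup.star_mul_self, one_mulVec]
  rw [key, key] at h
  exact_mod_cast h

theorem measurePreserving_mulVec_unitaryGroup (μ : Measure (Fin 4 → ℂ)) [μ.IsAddHaarMeasure]
    (V : Matrix.unitaryGroup (Fin 4) ℂ) :
    MeasurePreserving (fun w => (V : Matrix (Fin 4) (Fin 4) ℂ) *ᵥ w) μ μ := by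
  let f : (Fin 4 → ℂ) →ₗ[ℝ] (Fin 4 → ℂ) :=
    (Matrix.toLin' (V : Matrix (Fin 4) (Fin 4) ℂ)).restrictScalars ℝ
  have hdet : LinearMap.det f = 1 := by
    have := (Unitary.mem_iff.1 (Matrix.det_of_mem_unitary V.2)).1
    rw [LinearMap.det_restrictScalars, Algebra.norm_complex_apply, LinearMap.det_toLin']
    rw [RCLike.star_def, ← Complex.normSq_eq_conj_mul_self] at this
    exact_mod_cast this
  refine ⟨(LinearMap.continuous_of_finiteDimensional f).measurable, ?_⟩
  have := Measure.map_linearMap_addHaar_eq_smul_addHaar μ (f := f) (by rw [hdet]; exact one_ne_zero)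
  rw [hdet] at this
  change Measure.map f μ = μ
  simpa using this

instance : CompactSpace (Matrix.unitaryGroup (Fin 4) ℂ) := by
  have hclosed : IsClosed (Matrix.unitaryGroup (Fin 4) ℂ : Set (Matrix (Fin 4) (Fin 4) ℂ)) :=
    isClosed_unitary
  refine isCompact_iff_compactSpace.1
    (Metric.isCompact_of_isClosed_isBounded (α := Fin 4 → Fin 4 → ℂ) hclosed ?_)
  refine (Metric.isBounded_closedBall (x := (0 : Fin 4 → Fin 4 → ℂ)) (r := 1)).subset
    fun U hU => ?_
  rw [mem_closedBall_zero_iff, pi_norm_le_iff_of_nonneg zero_le_one]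
  intro i
  rw [pi_norm_le_iff_of_nonneg zero_le_one]
  exact entry_norm_bound_of_unitary hU i

/-- Every vector is the image of a multiple of the first basis vector under a unitary matrix. -/
theorem exists_unitaryGroup_mulVec_single (w : Fin 4 → ℂ) :
    ∃ U : Matrix.unitaryGroup (Fin 4) ℂ, (U : Matrix (Fin 4) (Fin 4) ℂ) *ᵥ
      (√(∑ i, ‖w i‖ ^ 2) • (Pi.single 0 1 : Fin 4 → ℂ)) = w := by
  by_cases hw : w = 0
  · exact ⟨1, by simp [hw]⟩
  let x : EuclideanSpace ℂ (Fin 4) := WithLp.toLp 2 w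
  have hx : ‖x‖ ≠ 0 := by simpa [x] using hw
  let u : EuclideanSpace ℂ (Fin 4) := (‖x‖⁻¹ : ℂ) • x
  have hu : ‖u‖ = 1 := by simp [u, norm_smul, hx]
  have hon : Orthonormal ℂ (Set.domRestrict {(0 : Fin 4)} fun _ => u) :=
    ⟨fun _ => hu, fun i j hij => (hij (Subsingleton.elim i j)).elim⟩
  obtain ⟨b, hb⟩ := hon.exists_orthonormalBasis_extension_of_card_eq (by simp)
  have hb0 : b 0 = u := hb 0 rfl
  refine ⟨⟨(EuclideanSpace.basisFun (Fin 4) ℂ).toBasis.toMatrix b,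
    OrthonormalBasis.toMatrix_orthonormalBasis_mem_unitary _ _⟩, ?_⟩
  ext i
  rw [mulVec_smul, mulVec_single_one]
  have hx' : (‖x‖ : ℂ) ≠ 0 := by exact_mod_cast hx
  have : √(∑ i, ‖w i‖ ^ 2) = ‖x‖ := by simp [x, EuclideanSpace.norm_eq]
  simp [this, Matrix.col_apply, Module.Basis.toMatrix_apply, hb0, u]
  simp [x, hx']

theorem continuous_mulVec_unitaryGroup :
    Continuous fun p : Matrix.unitaryGroup (Fin 4) ℂ × (Fin 4 → ℂ) =>
      (p.1 : Matrix (Fin 4) (Fin 4) ℂ) *ᵥ p.2 :=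
  (continuous_subtype_val.comp continuous_fst).matrix_mulVec continuous_snd

section Haar

variable [MeasurableSpace (Matrix.unitaryGroup (Fin 4) ℂ)]
  [BorelSpace (Matrix.unitaryGroup (Fin 4) ℂ)]
  (ν : Measure (Matrix.unitaryGroup (Fin 4) ℂ)) [ν.IsHaarMeasure] [IsProbabilityMeasure ν]

theorem integral_unitaryGroup_mul_right (f : Matrix.unitaryGroup (Fin 4) ℂ → ℝ)
    (U : Matrix.unitaryGroup (Fin 4) ℂ) : ∫ V, f (V * U) ∂ν = ∫ V, f V ∂ν := by
  have : IsProbabilityMeasure (Measure.map (· * U) ν) :=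
    Measure.isProbabilityMeasure_map (measurable_mul_const U).aemeasurable
  have h : Measure.map (· * U) ν = ν :=
    Measure.isHaarMeasure_eq_of_isProbabilityMeasure _ _
  conv_rhs => rw [← h]
  exact ((Homeomorph.mulRight U).measurableEmbedding.integral_map f).symm

theorem integral_schmidtGap_mulVec (w : Fin 4 → ℂ) :
    ∫ V, schmidtGap ((V : Matrix (Fin 4) (Fin 4) ℂ) *ᵥ w) ∂ν = (∑ i, ‖w i‖ ^ 2) *
      ∫ V, schmidtGap ((V : Matrix (Fin 4) (Fin 4) ℂ) *ᵥ (Pi.single 0 1 : Fin 4 → ℂ)) ∂ν := by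
  obtain ⟨U, hU⟩ := exists_unitaryGroup_mulVec_single w
  have hV (V : Matrix.unitaryGroup (Fin 4) ℂ) : schmidtGap ((V : Matrix (Fin 4) (Fin 4) ℂ) *ᵥ w) =
      (∑ i, ‖w i‖ ^ 2) * schmidtGap (((V * U : Matrix.unitaryGroup (Fin 4) ℂ) :
        Matrix (Fin 4) (Fin 4) ℂ) *ᵥ (Pi.single 0 1 : Fin 4 → ℂ)) := by
    conv_lhs => rw [← hU]
    rw [mulVec_mulVec, mulVec_smul, schmidtGap_smul, Real.sq_sqrt (by positivity)]
    rfl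
  simp only [hV]
  rw [integral_const_mul, integral_unitaryGroup_mul_right ν fun V =>
    schmidtGap ((V : Matrix (Fin 4) (Fin 4) ℂ) *ᵥ (Pi.single 0 1 : Fin 4 → ℂ))]

theorem integral_schmidtGap :
    ∫ V, schmidtGap ((V : Matrix (Fin 4) (Fin 4) ℂ) *ᵥ (Pi.single 0 1 : Fin 4 → ℂ)) ∂ν =
      3 / 4 := by
  set K := ∫ V, schmidtGap ((V : Matrix (Fin 4) (Fin 4) ℂ) *ᵥ (Pi.single 0 1 : Fin 4 → ℂ)) ∂ν
    with hK
  have hweight (V : Matrix.unitaryGroup (Fin 4) ℂ) (w : Fin 4 → ℂ) :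
      gaussWeight ((V : Matrix (Fin 4) (Fin 4) ℂ) *ᵥ w) = gaussWeight w := by
    rw [gaussWeight, sum_norm_sq_mulVec, gaussWeight]
  have hint : Integrable (Function.uncurry fun (V : Matrix.unitaryGroup (Fin 4) ℂ)
      (w : Fin 4 → ℂ) => schmidtGap ((V : Matrix (Fin 4) (Fin 4) ℂ) *ᵥ w) * gaussWeight w)
      (ν.prod magicMeasure) := by
    refine (integrable_normSq_mul_gaussWeight.comp_snd ν).mono' ?_ (.of_forall fun p => ?_)
    · exact ((continuous_schmidtGap.comp continuous_mulVec_unitaryGroup).mul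
        (continuous_gaussWeight.comp continuous_snd)).aestronglyMeasurable
    · rw [Function.uncurry, Real.norm_of_nonneg
        (mul_nonneg (schmidtGap_nonneg _) (gaussWeight_nonneg _)), ← sum_norm_sq_mulVec p.1]
      exact mul_le_mul_of_nonneg_right (schmidtGap_le _) (gaussWeight_nonneg _)
  have hswap := integral_integral_swap hint
  have hleft (V : Matrix.unitaryGroup (Fin 4) ℂ) :
      ∫ w, schmidtGap ((V : Matrix (Fin 4) (Fin 4) ℂ) *ᵥ w) * gaussWeight w ∂magicMeasure =
        6 * Real.pi ^ 4 := by
    rw [← integral_schmidtGap_mul_gaussWeight]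
    conv_rhs => rw [← (measurePreserving_mulVec_unitaryGroup magicMeasure V).map_eq]
    rw [integral_map]
    · simp only [hweight]
    · exact (measurePreserving_mulVec_unitaryGroup magicMeasure V).measurable.aemeasurable
    · exact (continuous_schmidtGap.mul continuous_gaussWeight).aestronglyMeasurable
  have hright (w : Fin 4 → ℂ) :
      ∫ V, schmidtGap ((V : Matrix (Fin 4) (Fin 4) ℂ) *ᵥ w) * gaussWeight w ∂ν =
        K * ((∑ i, ‖w i‖ ^ 2) * gaussWeight w) := by
    rw [integral_mul_const, integral_schmidtGap_mulVec, ← hK]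
    ring
  simp only [hleft, hright] at hswap
  rw [integral_const, probReal_univ, one_smul, integral_const_mul,
    integral_normSq_mul_gaussWeight] at hswap
  have : 0 < Real.pi ^ 4 := by positivity
  nlinarith

end Haar

theorem lambdaMax_mul_conjTranspose_reshape2 (ψ : Fin 4 → ℂ) :
    lambdaMax (reshape2 ψ * (reshape2 ψ)ᴴ) (Matrix.isHermitian_mul_conjTranspose_self _) =
      (∑ i, ‖ψ i‖ ^ 2 + schmidtGap ψ) / 2 := by
  set hA := Matrix.isHermitian_mul_conjTranspose_self (reshape2 ψ)
  have htrace : hA.eigenvalues 0 + hA.eigenvalues 1 = ∑ i, ‖ψ i‖ ^ 2 := by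
    have h := hA.trace_eq_sum_eigenvalues
    rw [Fin.sum_univ_two] at h
    have h' : (reshape2 ψ * (reshape2 ψ)ᴴ).trace = ((∑ i, ‖ψ i‖ ^ 2 : ℝ) : ℂ) := by
      simp [Matrix.trace, Matrix.mul_apply, reshape2, Fin.sum_univ_succ, Complex.mul_conj']
      ring
    rw [h'] at h
    exact Complex.ofReal_injective (by rw [Complex.ofReal_add]; exact h.symm)
  have hdet : hA.eigenvalues 0 * hA.eigenvalues 1 = ‖ψ 0 * ψ 3 - ψ 1 * ψ 2‖ ^ 2 := by
    have h := hA.det_eq_prod_eigenvalues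
    have h' : (reshape2 ψ).det = ψ 0 * ψ 3 - ψ 1 * ψ 2 := by
      rw [Matrix.det_fin_two]
      rfl
    rw [Fin.prod_univ_two, Matrix.det_mul, Matrix.det_conjTranspose, h', RCLike.star_def,
      Complex.mul_conj'] at h
    refine Complex.ofReal_injective ?_
    rw [Complex.ofReal_mul, Complex.ofReal_pow]
    exact h.symm
  have hmax : lambdaMax _ hA = max (hA.eigenvalues 0) (hA.eigenvalues 1) := by
    refine le_antisymm (Finset.sup'_le _ _ fun i _ => ?_)
      (max_le (Finset.le_sup' hA.eigenvalues (Finset.mem_univ 0))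
        (Finset.le_sup' hA.eigenvalues (Finset.mem_univ 1)))
    fin_cases i
    · exact le_max_left _ _
    · exact le_max_right _ _
  have hgap : schmidtGap ψ = |hA.eigenvalues 0 - hA.eigenvalues 1| := by
    rw [schmidtGap, ← htrace, ← hdet, ← Real.sqrt_sq_eq_abs]
    ring_nf
  rw [hmax, hgap, ← htrace]
  rcases le_total (hA.eigenvalues 0) (hA.eigenvalues 1) with h | h
  · rw [max_eq_right h, abs_of_nonpos (sub_nonpos.2 h)]
    ring
  · rw [max_eq_left h, abs_of_nonneg (sub_nonneg.2 h)]
    ring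

theorem re_dotProduct_mulVec_le_lambdaMax {A : Matrix (Fin 2) (Fin 2) ℂ} (hA : A.IsHermitian)
    (u : Fin 2 → ℂ) : (star u ⬝ᵥ (A *ᵥ u)).re ≤ lambdaMax A hA * (star u ⬝ᵥ u).re := by
  set Q : Matrix (Fin 2) (Fin 2) ℂ := hA.eigenvectorUnitary.1
  have hQ : Q * star Q = 1 := (Unitary.mem_iff.1 hA.eigenvectorUnitary.2).2
  set v : Fin 2 → ℂ := star Q *ᵥ u
  have hv : star u ᵥ* Q = star v := by
    rw [star_mulVec, star_eq_conjTranspose, conjTranspose_conjTranspose]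
  have hu : star u ⬝ᵥ u = star v ⬝ᵥ v := by
    rw [← hv, ← dotProduct_mulVec, mulVec_mulVec, hQ, one_mulVec]
  have hAu : star u ⬝ᵥ (A *ᵥ u) =
      star v ⬝ᵥ (diagonal (RCLike.ofReal ∘ hA.eigenvalues : Fin 2 → ℂ) *ᵥ v) := by
    conv_lhs => rw [hA.spectral_theorem, Unitary.conjStarAlgAut_apply]
    rw [← hv, ← dotProduct_mulVec, mulVec_mulVec, mulVec_mulVec]
  have hle (i : Fin 2) : hA.eigenvalues i ≤ lambdaMax A hA :=
    Finset.le_sup' hA.eigenvalues (Finset.mem_univ i)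
  rw [hAu, hu]
  simp only [dotProduct, mulVec_diagonal, Complex.re_sum, Finset.mul_sum]
  refine Finset.sum_le_sum fun i _ => ?_
  have h1 : star v i * ((RCLike.ofReal ∘ hA.eigenvalues) i * v i) =
      ((hA.eigenvalues i * Complex.normSq (v i) : ℝ) : ℂ) := by
    rw [Complex.ofReal_mul, Complex.normSq_eq_conj_mul_self]
    simp
    ring
  have h2 : star v i * v i = (Complex.normSq (v i) : ℂ) :=
    (Complex.normSq_eq_conj_mul_self).symm
  rw [h1, h2, Complex.ofReal_re, Complex.ofReal_re]
  exact mul_le_mul_of_nonneg_right (hle i) (Complex.normSq_nonneg _)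

theorem exists_mulVec_eq_lambdaMax_smul {A : Matrix (Fin 2) (Fin 2) ℂ} (hA : A.IsHermitian) :
    ∃ u : Fin 2 → ℂ, ∑ i, ‖u i‖ ^ 2 = 1 ∧ A *ᵥ u = lambdaMax A hA • u := by
  obtain ⟨j, -, hj⟩ := Finset.exists_mem_eq_sup' Finset.univ_nonempty hA.eigenvalues
  refine ⟨hA.eigenvectorBasis j, ?_, ?_⟩
  · rw [← EuclideanSpace.norm_sq_eq, hA.eigenvectorBasis.norm_eq_one, one_pow]
  · rw [lambdaMax, hj]
    exact hA.mulVec_eigenvectorBasis j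

theorem star_dotProduct_self_eq_sum_norm_sq {ι : Type*} [Fintype ι] (v : ι → ℂ) :
    star v ⬝ᵥ v = ((∑ i, ‖v i‖ ^ 2 : ℝ) : ℂ) := by
  simp [dotProduct, Complex.conj_mul']

theorem norm_dotProduct_sq_le {ι : Type*} [Fintype ι] (a b : ι → ℂ) :
    ‖a ⬝ᵥ b‖ ^ 2 ≤ (∑ i, ‖a i‖ ^ 2) * ∑ i, ‖b i‖ ^ 2 := by
  calc ‖a ⬝ᵥ b‖ ^ 2 ≤ (∑ i, ‖a i‖ * ‖b i‖) ^ 2 := by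
        gcongr
        exact (norm_sum_le _ _).trans_eq (by simp)
    _ ≤ _ := Finset.sum_mul_sq_le_sq_mul_sq _ _ _

/-- The squared norm of a row vector times `M` is a Rayleigh quotient of `M * Mᴴ`. -/
theorem sum_norm_sq_vecMul (M : Matrix (Fin 2) (Fin 2) ℂ) (v : Fin 2 → ℂ) :
    ((∑ i, ‖(v ᵥ* M) i‖ ^ 2 : ℝ) : ℂ) = v ⬝ᵥ ((M * Mᴴ) *ᵥ star v) := by
  rw [← star_dotProduct_self_eq_sum_norm_sq, dotProduct_comm, star_vecMul, ← dotProduct_mulVec,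
    mulVec_mulVec]

theorem norm_dotProduct_mulVec_sq_le (M : Matrix (Fin 2) (Fin 2) ℂ) {v v' : Fin 2 → ℂ}
    (hv : ∑ i, ‖v i‖ ^ 2 = 1) (hv' : ∑ i, ‖v' i‖ ^ 2 = 1) :
    ‖v ⬝ᵥ (M *ᵥ v')‖ ^ 2 ≤ lambdaMax (M * Mᴴ) (Matrix.isHermitian_mul_conjTranspose_self M) := by
  have h1 := norm_dotProduct_sq_le (v ᵥ* M) v'
  rw [← dotProduct_mulVec, hv', mul_one] at h1
  have h2 := re_dotProduct_mulVec_le_lambdaMax (Matrix.isHermitian_mul_conjTranspose_self M)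
    (star v)
  rw [star_star, ← sum_norm_sq_vecMul, dotProduct_comm, star_dotProduct_self_eq_sum_norm_sq,
    Complex.ofReal_re, Complex.ofReal_re, hv, mul_one] at h2
  exact h1.trans h2

theorem exists_unitaryGroup_fin_two_row_zero {v : Fin 2 → ℂ} (hv : ∑ i, ‖v i‖ ^ 2 = 1) :
    ∃ U : Matrix.unitaryGroup (Fin 2) ℂ, (U : Matrix (Fin 2) (Fin 2) ℂ) 0 = v := by
  refine ⟨⟨!![v 0, v 1; -star (v 1), star (v 0)], ?_⟩, ?_⟩
  · have h : v 0 * star (v 0) + v 1 * star (v 1) = 1 := by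
      rw [Fin.sum_univ_two] at hv
      simp only [RCLike.star_def, Complex.mul_conj']
      exact_mod_cast hv
    rw [Matrix.mem_unitaryGroup_iff]
    ext i j
    fin_cases i <;> fin_cases j <;>
      simp [Matrix.mul_apply, Matrix.star_apply, Fin.sum_univ_two] <;>
      simp at h <;> first | linear_combination h | ring
  · ext i
    fin_cases i <;> rfl

theorem exists_norm_dotProduct_mulVec_sq_eq (M : Matrix (Fin 2) (Fin 2) ℂ) :
    ∃ v v' : Fin 2 → ℂ, ∑ i, ‖v i‖ ^ 2 = 1 ∧ ∑ i, ‖v' i‖ ^ 2 = 1 ∧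
      ‖v ⬝ᵥ (M *ᵥ v')‖ ^ 2 =
        lambdaMax (M * Mᴴ) (Matrix.isHermitian_mul_conjTranspose_self M) := by
  obtain ⟨u, hu, hAu⟩ :=
    exists_mulVec_eq_lambdaMax_smul (Matrix.isHermitian_mul_conjTranspose_self M)
  set l := lambdaMax (M * Mᴴ) (Matrix.isHermitian_mul_conjTranspose_self M)
  set t : Fin 2 → ℂ := star u ᵥ* M
  have ht : ∑ i, ‖t i‖ ^ 2 = l := by
    have h := sum_norm_sq_vecMul M (star u)
    rw [star_star, hAu, dotProduct_smul, star_dotProduct_self_eq_sum_norm_sq, hu] at h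
    apply Complex.ofReal_injective
    simpa using h
  have hu' : ∑ i, ‖star u i‖ ^ 2 = 1 := by simpa using hu
  by_cases hl : l = 0
  · refine ⟨star u, u, hu', hu, ?_⟩
    have h := norm_dotProduct_mulVec_sq_le M hu' hu
    exact le_antisymm h (hl.trans_le (sq_nonneg _))
  have hlpos : 0 < l := lt_of_le_of_ne (ht ▸ by positivity) (Ne.symm hl)
  have hsq : √l ^ 2 = l := Real.sq_sqrt hlpos.le
  refine ⟨star u, (√l)⁻¹ • star t, hu', ?_, ?_⟩
  · simp only [Pi.smul_apply, norm_smul, mul_pow, ← Finset.mul_sum, Pi.star_apply, norm_star, ht]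
    simp [hsq, hl]
  · rw [dotProduct_mulVec, dotProduct_smul, dotProduct_comm, star_dotProduct_self_eq_sum_norm_sq,
      ht, norm_smul, mul_pow, norm_inv, inv_pow, Complex.norm_real, Real.norm_of_nonneg hlpos.le,
      Real.norm_of_nonneg (Real.sqrt_nonneg _), hsq]
    field_simp

theorem sum_norm_sq_unitaryGroup_row (U : Matrix.unitaryGroup (Fin 2) ℂ) (i : Fin 2) :
    ∑ j, ‖(U : Matrix (Fin 2) (Fin 2) ℂ) i j‖ ^ 2 = 1 := by
  have h := congrFun (congrFun (Matrix.mem_unitaryGroup_iff.1 U.2) i) i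
  simp only [Matrix.mul_apply, Matrix.star_apply, RCLike.star_def, Complex.mul_conj',
    Matrix.one_apply_eq] at h
  exact_mod_cast h

theorem rotatedAmp_eq_prod (m : ℕ) (V : Fin m → Matrix.unitaryGroup (Fin 4) ℂ)
    (W : Fin (2 * m) → Matrix.unitaryGroup (Fin 2) ℂ) (s : Fin (2 * m) → Fin 2) :
    rotatedAmp m V W s = ∏ i : Fin m,
      ((W ⟨2 * i.val, by omega⟩ : Matrix (Fin 2) (Fin 2) ℂ) (s ⟨2 * i.val, by omega⟩) ⬝ᵥ
        (reshape2 ((V i : Matrix (Fin 4) (Fin 4) ℂ) *ᵥ (Pi.single 0 1 : Fin 4 → ℂ)) *ᵥ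
          (W ⟨2 * i.val + 1, by omega⟩ : Matrix (Fin 2) (Fin 2) ℂ)
            (s ⟨2 * i.val + 1, by omega⟩))) := by
  refine Finset.prod_congr rfl fun i _ => ?_
  generalize (V i : Matrix (Fin 4) (Fin 4) ℂ) *ᵥ (Pi.single 0 1 : Fin 4 → ℂ) = ψ
  simp only [dotProduct, mulVec, Finset.mul_sum]
  refine Finset.sum_congr rfl fun c _ => Finset.sum_congr rfl fun d _ => ?_
  simp only [reshape2, Matrix.of_apply]
  ring

theorem isGreatest_peakWeight (m : ℕ) (V : Fin m → Matrix.unitaryGroup (Fin 4) ℂ) :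
    IsGreatest {x : ℝ | ∃ W : Fin (2 * m) → Matrix.unitaryGroup (Fin 2) ℂ,
      x = Finset.univ.sup' Finset.univ_nonempty
        fun s : Fin (2 * m) → Fin 2 => ‖rotatedAmp m V W s‖ ^ 2}
      (∏ i : Fin m, largestSchmidtWeight (V i)) := by
  have hle (W : Fin (2 * m) → Matrix.unitaryGroup (Fin 2) ℂ) (s : Fin (2 * m) → Fin 2) :
      ‖rotatedAmp m V W s‖ ^ 2 ≤ ∏ i : Fin m, largestSchmidtWeight (V i) := by
    rw [rotatedAmp_eq_prod, norm_prod, ← Finset.prod_pow]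
    exact Finset.prod_le_prod (fun _ _ => sq_nonneg _) fun i _ =>
      norm_dotProduct_mulVec_sq_le _ (sum_norm_sq_unitaryGroup_row _ _)
        (sum_norm_sq_unitaryGroup_row _ _)
  refine ⟨?_, ?_⟩
  · choose v v' hv hv' h using fun i : Fin m => exists_norm_dotProduct_mulVec_sq_eq
      (reshape2 ((V i : Matrix (Fin 4) (Fin 4) ℂ) *ᵥ (Pi.single 0 1 : Fin 4 → ℂ)))
    choose U hU using fun i => exists_unitaryGroup_fin_two_row_zero (hv i)
    choose U' hU' using fun i => exists_unitaryGroup_fin_two_row_zero (hv' i)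
    let W : Fin (2 * m) → Matrix.unitaryGroup (Fin 2) ℂ := fun j =>
      if j.val % 2 = 0 then U ⟨j.val / 2, by omega⟩ else U' ⟨j.val / 2, by omega⟩
    have hW (i : Fin m) : W ⟨2 * i.val, by omega⟩ = U i := by simp [W]
    have hW' (i : Fin m) : W ⟨2 * i.val + 1, by omega⟩ = U' i := by
      have h1 : (2 * i.val + 1) / 2 = i.val := by omega
      have h2 : (2 * i.val + 1) % 2 = 1 := by omega
      simp [W, h1, h2]
    refine ⟨W, le_antisymm ?_ (Finset.sup'_le _ _ fun s _ => hle W s)⟩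
    refine le_trans (le_of_eq ?_)
      (Finset.le_sup' (fun s => ‖rotatedAmp m V W s‖ ^ 2) (Finset.mem_univ 0))
    rw [rotatedAmp_eq_prod, norm_prod, ← Finset.prod_pow]
    refine Finset.prod_congr rfl fun i _ => ?_
    rw [hW, hW', Pi.zero_apply, Pi.zero_apply, hU, hU', h]
    rfl
  · rintro x ⟨W, rfl⟩
    exact Finset.sup'_le _ _ fun s _ => hle W s

theorem integral_largestSchmidtWeight [MeasurableSpace (Matrix.unitaryGroup (Fin 4) ℂ)]
    [BorelSpace (Matrix.unitaryGroup (Fin 4) ℂ)]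
    (ν : Measure (Matrix.unitaryGroup (Fin 4) ℂ)) [ν.IsHaarMeasure] [IsProbabilityMeasure ν] :
    ∫ V, largestSchmidtWeight V ∂ν = 7 / 8 := by
  have hV (V : Matrix.unitaryGroup (Fin 4) ℂ) : largestSchmidtWeight V =
      (1 + schmidtGap ((V : Matrix (Fin 4) (Fin 4) ℂ) *ᵥ (Pi.single 0 1 : Fin 4 → ℂ))) / 2 := by
    rw [largestSchmidtWeight, lambdaMax_mul_conjTranspose_reshape2, sum_norm_sq_mulVec]
    simp [Fin.sum_univ_succ]
  have hint : Integrable (fun V : Matrix.unitaryGroup (Fin 4) ℂ =>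
      schmidtGap ((V : Matrix (Fin 4) (Fin 4) ℂ) *ᵥ (Pi.single 0 1 : Fin 4 → ℂ))) ν :=
    .of_integral_ne_zero (by rw [integral_schmidtGap]; norm_num)
  simp only [hV]
  rw [integral_div, integral_add (integrable_const _) hint, integral_schmidtGap, integral_const,
    probReal_univ]
  norm_num

/-- **Expected optimal peak weight after one peaking layer of local rotations.**
Let `n = 2m > 0` and let `V₁, …, V_m` be independent Haar-random elements of `U(4)`
(distributed by the product of Haar probability measures `ν`), with `λᵢ` the largest
squared Schmidt coefficient of `Vᵢ|00⟩`.  Then `E[∏ᵢ λᵢ] = (7/8)^(n/2)`; consequently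
the expected optimal peak weight achievable by appending one layer of single-qubit
unitaries to `(V₁ ⊗ ⋯ ⊗ V_m)|0^n⟩` equals `(7/8)^(n/2)`, which exceeds the expected
peak weight `(25/48)^(n/2)` of the unrotated state. -/
theorem expected_optimal_peak_weight_one_peaking_layer
    (n m : ℕ) (hn : 0 < n) (hnm : n = 2 * m)
    [MeasurableSpace (Matrix.unitaryGroup (Fin 4) ℂ)]
    [BorelSpace (Matrix.unitaryGroup (Fin 4) ℂ)]
    (ν : Measure (Matrix.unitaryGroup (Fin 4) ℂ))
    [ν.IsHaarMeasure] [IsProbabilityMeasure ν] :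
    (∫ V, (∏ i : Fin m, largestSchmidtWeight (V i))
        ∂(Measure.pi fun _ : Fin m => ν) = (7 / 8 : ℝ) ^ m) ∧
    (∫ V, sSup {x : ℝ | ∃ W : Fin (2 * m) → Matrix.unitaryGroup (Fin 2) ℂ,
          x = Finset.univ.sup' Finset.univ_nonempty
                fun s : Fin (2 * m) → Fin 2 => ‖rotatedAmp m V W s‖ ^ 2}
        ∂(Measure.pi fun _ : Fin m => ν) = (7 / 8 : ℝ) ^ m) ∧
    (25 / 48 : ℝ) ^ m < (7 / 8 : ℝ) ^ m := by
  have hprod : ∫ V, (∏ i : Fin m, largestSchmidtWeight (V i))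
      ∂(Measure.pi fun _ : Fin m => ν) = (7 / 8 : ℝ) ^ m := by
    rw [integral_fintype_prod_eq_pow, integral_largestSchmidtWeight, Fintype.card_fin]
  refine ⟨hprod, ?_, pow_lt_pow_left₀ (by norm_num) (by norm_num) (by omega)⟩
  simp only [(isGreatest_peakWeight m _).csSup_eq]
  exact hprod
end
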